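/- arXiv:1904.04481 — 5 statements merged into one kernel-verified Lean document; each statement's English description precedes it below -/
import Mathlib

section
/- Let R be a commutative ring with elements h_1, h_2, h_3, … ∈ R. For every composition a = (a_1, …, a_s) of a positive integer n with s ≥ 2, the element Ψ(a) satisfies the recursion Ψ(a_1, …, a_s) = Ψ(a_1, …, a_{s−1})·h_{a_s} − Ψ(a_1, …, a_{s−2}, a_{s−1} + a_s). -/
/-- A composition of `n`: a list of positive integers summing to `n`. -/
def IsComposition (n : ℕ) (a : List ℕ) : Prop :=
  (∀ x ∈ a, 0 < x) ∧ a.sum = n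

/-- `b` is a coarsening of `a`: `b` is obtained by summing consecutive nonempty blocks of `a`. -/
def Coarsen (a b : List ℕ) : Prop :=
  ∃ L : List (List ℕ), (∀ l ∈ L, l ≠ []) ∧ L.flatten = a ∧ b = L.map List.sum

/-- `Ψ(a) = Σ_{a ⪯ b} (−1)^{l(b)−l(a)} h_{b_1} ⋯ h_{b_{l(b)}}`, summed over all
coarsenings `b` of `a` (a finite set).  Since `l(b) ≤ l(a)`, the sign
`(−1)^{l(b)−l(a)}` equals `(−1)^{l(a)−l(b)}`. -/
noncomputable def Psi {R : Type*} [CommRing R] (h : ℕ → R) (a : List ℕ) : R :=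
  ∑ᶠ b ∈ {b : List ℕ | Coarsen a b},
    (-1 : R) ^ (a.length - b.length) * (b.map h).prod

/-- A coarsening of `l ++ [x]` is a coarsening of a prefix of `l` followed by one block ending
in `x`. -/
theorem coarsen_append_singleton_iff {l b : List ℕ} {x : ℕ} :
    Coarsen (l ++ [x]) b ↔ ∃ (L : List (List ℕ)) (m : List ℕ),
      (∀ k ∈ L, k ≠ []) ∧ L.flatten ++ m = l ∧ b = L.map List.sum ++ [m.sum + x] := by
  constructor
  · rintro ⟨L, hL, hf, rfl⟩
    rcases List.eq_nil_or_concat L with rfl | ⟨L, k, rfl⟩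
    · simp at hf
    · rcases List.eq_nil_or_concat k with rfl | ⟨m, z, rfl⟩
      · exact absurd rfl (hL [] (by simp))
      · simp only [List.concat_eq_append, List.flatten_append, List.flatten_cons,
          List.flatten_nil, List.append_nil, ← List.append_assoc] at hf
        obtain ⟨hlm, hz⟩ := List.append_inj' hf rfl
        obtain rfl : z = x := by simpa using hz
        exact ⟨L, m, fun k hk => hL k (by simp [hk]), hlm, by simp⟩
  · rintro ⟨L, m, hL, rfl, rfl⟩
    refine ⟨L ++ [m ++ [x]], ?_, by simp, by simp⟩
    intro k hk
    rcases List.mem_append.1 hk with hk | hk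
    · exact hL k hk
    · simp_all

/-- In a coarsening of `l ++ [x, y]`, either `y` is a block of its own, or it is merged
with `x`. -/
theorem setOf_coarsen_append_pair (l : List ℕ) (x y : ℕ) :
    {b | Coarsen (l ++ [x, y]) b} =
      (fun b => b ++ [y]) '' {b | Coarsen (l ++ [x]) b} ∪ {b | Coarsen (l ++ [x + y]) b} := by
  ext b
  have hl : l ++ [x, y] = (l ++ [x]) ++ [y] := by simp
  simp only [Set.mem_union, Set.mem_image, Set.mem_ofPred_eq]
  rw [hl, coarsen_append_singleton_iff]
  constructor
  · rintro ⟨L, m, hL, hf, rfl⟩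
    rcases List.eq_nil_or_concat m with rfl | ⟨m, z, rfl⟩
    · exact Or.inl ⟨_, ⟨L, hL, by simpa using hf, rfl⟩, by simp⟩
    · rw [List.concat_eq_append, ← List.append_assoc] at hf
      obtain ⟨hlm, hz⟩ := List.append_inj' hf rfl
      obtain rfl : z = x := by simpa using hz
      exact Or.inr (coarsen_append_singleton_iff.2
        ⟨L, m, hL, hlm, by simp [Nat.add_assoc]⟩)
  · rintro (⟨b, ⟨L, hL, hf, rfl⟩, rfl⟩ | hb)
    · exact ⟨L, [], hL, by simpa using hf, by simp⟩
    · obtain ⟨L, m, hL, rfl, rfl⟩ := coarsen_append_singleton_iff.1 hb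
      exact ⟨L, m ++ [x], hL, by simp, by simp [Nat.add_assoc]⟩

theorem Coarsen.length_le {a b : List ℕ} (hab : Coarsen a b) : b.length ≤ a.length := by
  obtain ⟨L, hL, rfl, rfl⟩ := hab
  induction L with
  | nil => simp
  | cons k L ih =>
    have hk := List.length_pos_iff.2 (hL k (by simp))
    have := ih fun k hk => hL k (by simp [hk])
    simp only [List.map_cons, List.length_cons, List.flatten_cons, List.length_append] at *
    omega

theorem finite_setOf_coarsen (a : List ℕ) : {b | Coarsen a b}.Finite := by
  induction hn : a.length using Nat.strong_induction_on generalizing a with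
  | _ n ih =>
    rcases List.eq_nil_or_concat a with rfl | ⟨a, y, rfl⟩
    · refine (Set.finite_singleton []).subset fun b hb => ?_
      simpa using Coarsen.length_le hb
    · rcases List.eq_nil_or_concat a with rfl | ⟨l, x, rfl⟩
      · refine (Set.finite_singleton [y]).subset fun b hb => ?_
        obtain ⟨L, m, hL, hf, rfl⟩ := coarsen_append_singleton_iff (l := []).1 hb
        obtain ⟨hflat, rfl⟩ := List.append_eq_nil_iff.1 hf
        cases L with
        | nil => simp
        | cons k L => exact absurd (List.append_eq_nil_iff.1 hflat).1 (hL k (by simp))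
      · simp only [List.concat_eq_append, List.append_assoc, List.cons_append, List.nil_append,
          List.length_append, List.length_cons, List.length_nil] at hn ⊢
        rw [setOf_coarsen_append_pair]
        exact ((ih (l.length + 1) (by omega) _ (by simp)).image _).union
          (ih (l.length + 1) (by omega) _ (by simp))

/-- The recursion `Ψ(a_1,…,a_s) = Ψ(a_1,…,a_{s−1})·h_{a_s} − Ψ(a_1,…,a_{s−2},a_{s−1}+a_s)`
for a composition of a positive integer `n` with `s ≥ 2` parts (here written as
`l ++ [x, y]`, so `x = a_{s−1}` and `y = a_s`). -/
theorem Psi_recursion {R : Type*} [CommRing R] (h : ℕ → R)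
    (n : ℕ) (hn : 0 < n) (l : List ℕ) (x y : ℕ)
    (ha : IsComposition n (l ++ [x, y])) :
    Psi h (l ++ [x, y]) = Psi h (l ++ [x]) * h y - Psi h (l ++ [x + y]) := by
  have hx : 0 < x := ha.1 x (by simp)
  have hdisj : Disjoint ((fun b => b ++ [y]) '' {b | Coarsen (l ++ [x]) b})
      {b | Coarsen (l ++ [x + y]) b} := by
    rw [Set.disjoint_left]
    rintro _ ⟨b, -, rfl⟩ hb
    obtain ⟨L, m, -, -, hb⟩ := coarsen_append_singleton_iff.1 hb
    have := (List.append_inj' hb rfl).2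
    simp only [List.cons.injEq, and_true] at this
    omega
  unfold Psi
  rw [setOf_coarsen_append_pair,
    finsum_mem_union hdisj ((finite_setOf_coarsen _).image _) (finite_setOf_coarsen _),
    finsum_mem_image (List.append_left_injective [y]).injOn, sub_eq_add_neg,
    finsum_mem_mul' _ _ (finite_setOf_coarsen _),
    ← finsum_mem_neg_distrib _ (finite_setOf_coarsen _)]
  congr 1
  · refine finsum_mem_congr rfl fun b _ => ?_
    simp [mul_assoc]
  · refine finsum_mem_congr rfl fun b hb => ?_
    have hlen : b.length ≤ l.length + 1 := by simpa using Coarsen.length_le hb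
    have hsub : (l ++ [x, y]).length - b.length = (l ++ [x + y]).length - b.length + 1 := by
      simp only [List.length_append, List.length_cons, List.length_nil]
      omega
    rw [hsub, pow_succ]
    ring
end

section
/- Let R be a commutative ring with elements h_1, h_2, h_3, … ∈ R and let a = (a_1, …, a_s) be a composition of a positive integer n. Then Ψ(a) = det M(a), where M(a) is the s × s matrix over R with entries M_{ij} = h_{a_i + a_{i+1} + ⋯ + a_j} if i ≤ j, M_{ij} = 1 if i = j + 1, and M_{ij} = 0 if i > j + 1. -/
theorem coarsen_singleton {x : ℕ} {b : List ℕ} : Coarsen [x] b ↔ b = [x] := by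
  constructor
  · rintro ⟨L, hL, hf, rfl⟩
    match L, hL, hf with
    | (z :: l) :: L, hL, hf =>
      obtain ⟨rfl, hf'⟩ : z = x ∧ l ++ L.flatten = [] := by simpa using hf
      obtain ⟨rfl, hf⟩ := List.append_eq_nil_iff.1 hf'
      match L, hL, hf with
      | [], _, _ => simp
      | (_ :: _) :: _, _, hf => simp at hf
      | [] :: _, hL, _ => simp at hL
    | [] :: _, hL, _ => simp at hL
  · rintro rfl
    exact ⟨[[x]], by simp, by simp, by simp⟩

/-- In a coarsening the first part is either kept alone or merged with the second one. -/
theorem coarsen_cons_cons {x y : ℕ} {t b : List ℕ} :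
    Coarsen (x :: y :: t) b ↔
      (∃ c, Coarsen (y :: t) c ∧ x :: c = b) ∨ Coarsen ((x + y) :: t) b := by
  constructor
  · rintro ⟨L, hL, hf, rfl⟩
    match L, hL, hf with
    | [z] :: L, hL, hf =>
      obtain ⟨rfl, hf'⟩ : z = x ∧ L.flatten = y :: t := by simpa using hf
      exact Or.inl ⟨_, ⟨L, fun l hl => hL l (by simp [hl]), hf', rfl⟩, by simp⟩
    | (z :: w :: l) :: L, hL, hf =>
      obtain ⟨rfl, rfl, hf'⟩ : z = x ∧ w = y ∧ l ++ L.flatten = t := by simpa using hf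
      refine Or.inr ⟨((z + w) :: l) :: L, ?_, by simpa using hf', by simp [add_assoc]⟩
      simpa using fun l hl => hL l (by simp [hl])
    | [] :: _, hL, _ => simp at hL
  · rintro (⟨c, ⟨L, hL, hf, rfl⟩, rfl⟩ | ⟨L, hL, hf, rfl⟩)
    · exact ⟨[x] :: L, by simpa using hL, by simpa using hf, by simp⟩
    · match L, hL, hf with
      | (z :: l) :: L, hL, hf =>
        obtain ⟨rfl, hf'⟩ : z = x + y ∧ l ++ L.flatten = t := by simpa using hf
        refine ⟨(x :: y :: l) :: L, ?_, by simpa using hf', by simp [add_assoc]⟩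
        simpa using fun l hl => hL l (by simp [hl])
      | [] :: _, hL, _ => simp at hL

theorem setOf_coarsen_cons_cons (x y : ℕ) (t : List ℕ) :
    {b | Coarsen (x :: y :: t) b} =
      (x :: ·) '' {c | Coarsen (y :: t) c} ∪ {b | Coarsen ((x + y) :: t) b} := by
  ext b
  simp [coarsen_cons_cons]

theorem finite_setOf_coarsen_cons (x : ℕ) (t : List ℕ) : {b | Coarsen (x :: t) b}.Finite := by
  induction t generalizing x with
  | nil => simp [coarsen_singleton]
  | cons y t ih =>
    rw [setOf_coarsen_cons_cons]
    exact ((ih y).image _).union (ih (x + y))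

theorem Coarsen.length_le_s1 {x : ℕ} {t b : List ℕ} (hb : Coarsen (x :: t) b) :
    b.length ≤ t.length + 1 := by
  induction t generalizing x b with
  | nil => simp [coarsen_singleton.1 hb]
  | cons y t ih =>
    rcases coarsen_cons_cons.1 hb with ⟨c, hc, rfl⟩ | hb
    · simpa using ih hc
    · exact (ih hb).trans (by simp)

theorem Coarsen.le_head {x z : ℕ} {t b : List ℕ} (hb : Coarsen (x :: t) (z :: b)) : x ≤ z := by
  induction t generalizing x with
  | nil => simp_all [coarsen_singleton]
  | cons y t ih =>
    rcases coarsen_cons_cons.1 hb with ⟨c, hc, h⟩ | hb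
    · simp_all
    · exact (Nat.le_add_right x y).trans (ih hb)

theorem Psi_singleton {R : Type*} [CommRing R] (h : ℕ → R) (x : ℕ) : Psi h [x] = h x := by
  simp [Psi, coarsen_singleton]

theorem Psi_cons_cons {R : Type*} [CommRing R] (h : ℕ → R) (x : ℕ) {y : ℕ} (hy : 0 < y)
    (t : List ℕ) :
    Psi h (x :: y :: t) = h x * Psi h (y :: t) - Psi h ((x + y) :: t) := by
  have hdisj : Disjoint ((x :: ·) '' {c | Coarsen (y :: t) c})
      {b | Coarsen ((x + y) :: t) b} := by
    rw [Set.disjoint_left]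
    rintro _ ⟨c, -, rfl⟩ hb
    have := Coarsen.le_head hb
    omega
  unfold Psi
  rw [setOf_coarsen_cons_cons, finsum_mem_union hdisj ((finite_setOf_coarsen_cons y t).image _)
    (finite_setOf_coarsen_cons (x + y) t), finsum_mem_image (by simp [Set.InjOn]), sub_eq_add_neg,
    mul_finsum_mem' _ _ (finite_setOf_coarsen_cons y t),
    ← finsum_mem_neg_distrib _ (finite_setOf_coarsen_cons (x + y) t)]
  congr 1
  · refine finsum_mem_congr rfl fun c _ => ?_
    simp only [List.length_cons, Nat.add_sub_add_right, List.map_cons, List.prod_cons]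
    ring
  · refine finsum_mem_congr rfl fun b hb => ?_
    have hle : b.length ≤ t.length + 1 := Coarsen.length_le_s1 hb
    simp only [List.length_cons]
    rw [Nat.succ_sub hle, pow_succ]
    ring

/-- The entries of `M(a)`, indexed by natural numbers. -/
def psiEntry {R : Type*} [CommRing R] (h : ℕ → R) (a : List ℕ) (i j : ℕ) : R :=
  if i ≤ j then h (∑ k ∈ Finset.Icc i j, a.getD k 0) else if i = j + 1 then 1 else 0

theorem sum_Icc_succ_getD_cons (x : ℕ) (t : List ℕ) (i j : ℕ) :
    ∑ k ∈ Finset.Icc (i + 1) (j + 1), (x :: t).getD k 0 = ∑ k ∈ Finset.Icc i j, t.getD k 0 := by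
  rw [← Finset.map_add_right_Icc, Finset.sum_map]
  simp

theorem psiEntry_cons_succ_succ {R : Type*} [CommRing R] (h : ℕ → R) (x : ℕ) (t : List ℕ)
    (i j : ℕ) : psiEntry h (x :: t) (i + 1) (j + 1) = psiEntry h t i j := by
  simp only [psiEntry, sum_Icc_succ_getD_cons, Nat.add_le_add_iff_right, Nat.add_right_cancel_iff]

theorem psiEntry_cons_succ_congr {R : Type*} [CommRing R] (h : ℕ → R) (x y : ℕ) (t : List ℕ)
    (i j : ℕ) : psiEntry h (x :: t) (i + 1) j = psiEntry h (y :: t) (i + 1) j := by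
  cases j with
  | zero => simp [psiEntry]
  | succ j => rw [psiEntry_cons_succ_succ, psiEntry_cons_succ_succ]

theorem psiEntry_cons_cons_zero_succ {R : Type*} [CommRing R] (h : ℕ → R) (x y : ℕ) (t : List ℕ)
    (j : ℕ) : psiEntry h (x :: y :: t) 0 (j + 1) = psiEntry h ((x + y) :: t) 0 j := by
  have hsum : ∑ k ∈ Finset.Icc 0 (j + 1), (x :: y :: t).getD k 0 =
      ∑ k ∈ Finset.Icc 0 j, ((x + y) :: t).getD k 0 := by
    simp only [← Nat.range_succ_eq_Icc_zero]
    rw [Finset.sum_range_succ', Finset.sum_range_succ', Finset.sum_range_succ']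
    simp only [List.getD_cons_succ, List.getD_cons_zero]
    ring
  simp only [psiEntry, Nat.zero_le, if_true, hsum]

theorem det_psiEntry_cons_cons {R : Type*} [CommRing R] (h : ℕ → R) (x y : ℕ) (t : List ℕ) :
    Matrix.det (Matrix.of fun i j : Fin (t.length + 2) => psiEntry h (x :: y :: t) i j) =
      h x * Matrix.det (Matrix.of fun i j : Fin (t.length + 1) => psiEntry h (y :: t) i j) -
        Matrix.det
          (Matrix.of fun i j : Fin (t.length + 1) => psiEntry h ((x + y) :: t) i j) := by
  rw [Matrix.det_succ_column_zero, Fin.sum_univ_succ, Fin.sum_univ_succ, Finset.sum_eq_zero,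
    add_zero, sub_eq_add_neg]
  · congr 1
    · have hM : (Matrix.of fun i j : Fin (t.length + 2) =>
          psiEntry h (x :: y :: t) i j).submatrix (Fin.succAbove 0) Fin.succ =
          Matrix.of fun i j : Fin (t.length + 1) => psiEntry h (y :: t) i j := by
        ext i j
        simp [psiEntry_cons_succ_succ]
      rw [hM]
      simp [psiEntry]
    · have hM : (Matrix.of fun i j : Fin (t.length + 2) =>
          psiEntry h (x :: y :: t) i j).submatrix (Fin.succAbove (Fin.succ 0)) Fin.succ =
          Matrix.of fun i j : Fin (t.length + 1) => psiEntry h ((x + y) :: t) i j := by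
        ext i j
        refine Fin.cases ?_ (fun i => ?_) i
        · simp [psiEntry_cons_cons_zero_succ]
        · simp [psiEntry_cons_succ_succ, psiEntry_cons_succ_congr h y (x + y)]
      rw [hM]
      simp [psiEntry]
  · intro i _
    simp [psiEntry]

theorem Psi_cons_eq_det {R : Type*} [CommRing R] (h : ℕ → R) (x : ℕ) (t : List ℕ)
    (ht : ∀ y ∈ t, 0 < y) :
    Psi h (x :: t) =
      Matrix.det (Matrix.of fun i j : Fin (t.length + 1) => psiEntry h (x :: t) i j) := by
  induction t generalizing x with
  | nil => simp [Psi_singleton, psiEntry]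
  | cons y t ih =>
    have ht' : ∀ z ∈ t, 0 < z := fun z hz => ht z (by simp [hz])
    rw [Psi_cons_cons h x (ht y (by simp)), ih y ht', ih (x + y) ht']
    exact (det_psiEntry_cons_cons h x y t).symm


/-- `Ψ(a) = det M(a)` where `M(a)_{ij} = h_{a_i + ⋯ + a_j}` for `i ≤ j`,
`M(a)_{ij} = 1` for `i = j + 1`, and `M(a)_{ij} = 0` otherwise (0-indexed here). -/
theorem Psi_det {R : Type*} [CommRing R] (h : ℕ → R)
    (n : ℕ) (hn : 0 < n) (a : List ℕ) (ha : IsComposition n a) :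
    Psi h a = Matrix.det (Matrix.of fun i j : Fin a.length =>
      if (i : ℕ) ≤ (j : ℕ) then h (∑ k ∈ Finset.Icc (i : ℕ) (j : ℕ), a.getD k 0)
      else if (i : ℕ) = (j : ℕ) + 1 then 1 else 0) := by
  obtain ⟨hpos, hsum⟩ := ha
  cases a with
  | nil => simp at hsum; omega
  | cons x t => exact Psi_cons_eq_det h x t fun y hy => hpos y (by simp [hy])
end

section
/- Let R be a commutative ring with elements e_0, e_1, e_2, … and h_0, h_1, h_2, … satisfying e_0 = h_0 = 1 and Σ_{m=0}^{j} (−1)^m e_m h_{j−m} = 0 for every j ≥ 1. For integers a ≥ 1 and b ≥ 0, define the hook element s_{a,1^b} := Σ_{j=0}^{b} (−1)^j e_{b−j} h_{a+j} ∈ R. Then for every n ≥ 1 the following two identities hold in the Laurent polynomial ring R[q, q^{−1}]: (i) Σ_{i=0}^{n} (−1)^{n−i} q^{n−2i} e_i h_{n−i} = (q^{−1} − q) · Σ_{i=0}^{n−1} (−1)^{n−1−i} q^{n−1−2i} s_{n−i,1^i}; (ii) Σ_{i=0}^{n} (−1)^{i} q^{2i−n} e_i h_{n−i} = (q^{−1}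 − q) · Σ_{i=0}^{n−1} (−1)^{i} q^{2i−n+1} s_{n−i,1^i}. -/
open LaurentPolynomial

/-- The hook Schur element `s_{a,1^b} := Σ_{j=0}^{b} (−1)^j e_{b−j} h_{a+j}`. -/
def hookSchur {R : Type*} [CommRing R] (e h : ℕ → R) (a b : ℕ) : R :=
  ∑ j ∈ Finset.range (b + 1), (-1 : R) ^ j * e (b - j) * h (a + j)

lemma hookSchur_zero_right {R : Type*} [CommRing R] (e h : ℕ → R) (he0 : e 0 = 1) (a : ℕ) :
    hookSchur e h a 0 = h a := by
  simp [hookSchur, he0]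

/-- The Pieri rule `e_{b+1} h_a = s_{a,1^{b+1}} + s_{a+1,1^b}`. -/
lemma mul_eq_hookSchur_add {R : Type*} [CommRing R] (e h : ℕ → R) (a b : ℕ) :
    e (b + 1) * h a = hookSchur e h a (b + 1) + hookSchur e h (a + 1) b := by
  unfold hookSchur
  rw [Finset.sum_range_succ', add_right_comm, ← Finset.sum_add_distrib, Finset.sum_eq_zero]
  · simp
  · intro j _
    rw [Nat.add_sub_add_right, add_assoc a 1 j, add_comm 1 j, pow_succ]
    ring

lemma hookSchur_zero_left {R : Type*} [CommRing R] (e h : ℕ → R) (n : ℕ)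
    (rel : ∑ m ∈ Finset.range (n + 1), (-1 : R) ^ m * e m * h (n - m) = 0) :
    hookSchur e h 0 n = 0 := by
  unfold hookSchur
  rw [← Finset.sum_range_reflect, ← mul_zero ((-1 : R) ^ n), ← rel, Finset.mul_sum]
  refine Finset.sum_congr rfl fun m hm => ?_
  obtain ⟨k, rfl⟩ := Nat.exists_eq_add_of_le (Nat.lt_succ_iff.mp (Finset.mem_range.mp hm))
  have h1 : m + k + 1 - 1 - m = k := by omega
  have h2 : m + k - k = m := by omega
  have h3 : m + k - m = k := by omega
  have h4 : (-1 : R) ^ m * (-1) ^ m = 1 := by rw [← mul_pow]; simp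
  rw [h1, h2, h3, zero_add, pow_add]
  linear_combination (-(-1 : R) ^ k * e m * h k) * h4

/-- Summation by parts for `x i = s i + s (i - 1)`: if the weights satisfy
`w i + w (i + 1) = d * v i`, then `∑ w i * x i = d * ∑ v i * s i` up to a boundary term. -/
lemma sum_mul_eq_mul_sum_add {A : Type*} [CommRing A] (d : A) (w v x s : ℕ → A) (n : ℕ)
    (hx0 : x 0 = s 0) (hx : ∀ i < n, x (i + 1) = s (i + 1) + s i)
    (hw : ∀ i < n, w i + w (i + 1) = d * v i) :
    ∑ i ∈ Finset.range (n + 1), w i * x i =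
      d * ∑ i ∈ Finset.range n, v i * s i + w n * s n := by
  induction n with
  | zero => simp [hx0]
  | succ n ih =>
    rw [Finset.sum_range_succ, ih (fun i hi => hx i (by omega)) (fun i hi => hw i (by omega)),
      Finset.sum_range_succ _ n, hx n (by omega)]
    linear_combination s n * hw n (by omega)

/-- The two plethystic identities of Lemma `plethcomplete`, in the Laurent
polynomial ring `R[q, q⁻¹]` (with `q = T 1`, `q⁻¹ = T (-1)`):
(i)  `Σ_{i=0}^{n} (−1)^{n−i} q^{n−2i} e_i h_{n−i}
       = (q⁻¹ − q) · Σ_{i=0}^{n−1} (−1)^{n−1−i} q^{n−1−2i} s_{n−i,1^i}`;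
(ii) `Σ_{i=0}^{n} (−1)^{i} q^{2i−n} e_i h_{n−i}
       = (q⁻¹ − q) · Σ_{i=0}^{n−1} (−1)^{i} q^{2i−n+1} s_{n−i,1^i}`. -/
theorem plethysm_identities {R : Type*} [CommRing R] (e h : ℕ → R)
    (he0 : e 0 = 1) (hh0 : h 0 = 1)
    (rel : ∀ j : ℕ, 1 ≤ j →
      ∑ m ∈ Finset.range (j + 1), (-1 : R) ^ m * e m * h (j - m) = 0)
    (n : ℕ) (hn : 1 ≤ n) :
    (∑ i ∈ Finset.range (n + 1),
        (-1 : LaurentPolynomial R) ^ (n - i) * T ((n : ℤ) - 2 * i) * C (e i * h (n - i))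
      = (T (-1) - T 1) *
        ∑ i ∈ Finset.range n,
          (-1 : LaurentPolynomial R) ^ (n - 1 - i) * T ((n : ℤ) - 1 - 2 * i) *
            C (hookSchur e h (n - i) i)) ∧
    (∑ i ∈ Finset.range (n + 1),
        (-1 : LaurentPolynomial R) ^ i * T (2 * (i : ℤ) - n) * C (e i * h (n - i))
      = (T (-1) - T 1) *
        ∑ i ∈ Finset.range n,
          (-1 : LaurentPolynomial R) ^ i * T (2 * (i : ℤ) - n + 1) *
            C (hookSchur e h (n - i) i)) := by
  have hx0 : C (e 0 * h (n - 0)) = C (hookSchur e h (n - 0) 0) := by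
    rw [hookSchur_zero_right e h he0, he0, one_mul]
  have hx : ∀ i < n, C (e (i + 1) * h (n - (i + 1))) =
      C (hookSchur e h (n - (i + 1)) (i + 1)) + C (hookSchur e h (n - i) i) := by
    intro i hi
    rw [mul_eq_hookSchur_add, map_add, show n - (i + 1) + 1 = n - i by omega]
  have hs : C (hookSchur e h (n - n) n) = 0 := by
    rw [Nat.sub_self, hookSchur_zero_left e h n (rel n hn), map_zero]
  constructor
  · have key := sum_mul_eq_mul_sum_add (T (-1) - T 1)
      (fun i => (-1 : LaurentPolynomial R) ^ (n - i) * T ((n : ℤ) - 2 * i))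
      (fun i => (-1 : LaurentPolynomial R) ^ (n - 1 - i) * T ((n : ℤ) - 1 - 2 * i))
      (fun i => C (e i * h (n - i))) (fun i => C (hookSchur e h (n - i) i)) n hx0 hx ?_
    · simpa only [hs, mul_zero, add_zero] using key
    · intro i hi
      have h1 : n - i = n - 1 - i + 1 := by omega
      have h2 : n - (i + 1) = n - 1 - i := by omega
      have h3 : (n : ℤ) - 2 * i = 1 + (n - 1 - 2 * i) := by ring
      have h4 : (n : ℤ) - 2 * (i + 1 : ℕ) = -1 + (n - 1 - 2 * i) := by push_cast; ring
      simp only [h1, h2, h3, h4, T_add, pow_succ]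
      ring
  · have key := sum_mul_eq_mul_sum_add (T (-1) - T 1)
      (fun i => (-1 : LaurentPolynomial R) ^ i * T (2 * (i : ℤ) - n))
      (fun i => (-1 : LaurentPolynomial R) ^ i * T (2 * (i : ℤ) - n + 1))
      (fun i => C (e i * h (n - i))) (fun i => C (hookSchur e h (n - i) i)) n hx0 hx ?_
    · simpa only [hs, mul_zero, add_zero] using key
    · intro i _
      have h1 : 2 * (i : ℤ) - n = -1 + (2 * i - n + 1) := by ring
      have h2 : 2 * ((i + 1 : ℕ) : ℤ) - n = 1 + (2 * i - n + 1) := by push_cast; ring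
      generalize 2 * (i : ℤ) - n + 1 = m at h1 h2 ⊢
      simp only [h1, h2, T_add, pow_succ]
      ring
end

section
/- Let 𝒞 be an additive category and let 𝒦 be the bounded homotopy category of 𝒞 (objects are bounded cochain complexes over 𝒞, morphisms are chain maps up to chain homotopy). Let A be an object of 𝒦 and let p : A → A be a morphism with p ∘ p = p in 𝒦 (i.e., p² is chain homotopic to p). Then for every odd integer n ≥ 1 there exist objects P and Q of 𝒦 and an isomorphism φ : A ⊕ A[n] ≅ P ⊕ Q in 𝒦 such that the endomorphism φ ∘ (p ⊕ p[n]) ∘ φ^{−1} of P ⊕ Q equals id_P ⊕ 0, i.e., p acts as the identity on P and by zero on Q. -/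
open CategoryTheory Limits

/-- A cochain complex is bounded if its terms vanish outside finitely many degrees. -/
def CochainComplex.IsBoundedComplex {C : Type*} [Category C] [Limits.HasZeroMorphisms C]
    (A : CochainComplex C ℤ) : Prop :=
  ∃ a b : ℤ, ∀ i : ℤ, (i < a ∨ b < i) → Limits.IsZero (A.X i)

/-- Data exhibiting `U` as the direct sum of the formal images of an endomorphism `a` of `X`
and an endomorphism `b` of `Y` (both are then necessarily idempotent). -/
structure CategoryTheory.ImageDecomposition {T : Type*} [Category T] [Preadditive T]
    (U : T) {X Y : T} (a : X ⟶ X) (b : Y ⟶ Y) where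
  /-- The map from the first object. -/
  inl : X ⟶ U
  /-- The map to the first object. -/
  fst : U ⟶ X
  /-- The map from the second object. -/
  inr : Y ⟶ U
  /-- The map to the second object. -/
  snd : U ⟶ Y
  inl_fst : inl ≫ fst = a
  inr_snd : inr ≫ snd = b
  inl_snd : inl ≫ snd = 0
  inr_fst : inr ≫ fst = 0
  total : fst ≫ inl + snd ≫ inr = 𝟙 U

namespace CategoryTheory.ImageDecomposition

attribute [simp] inl_fst inr_snd inl_snd inr_fst

section Preadditive

variable {T : Type*} [Category T] [Preadditive T] {U X Y : T} {a : X ⟶ X} {b : Y ⟶ Y}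

/-- Exchange the two summands. -/
def swap (d : ImageDecomposition U a b) : ImageDecomposition U b a where
  inl := d.inr
  fst := d.snd
  inr := d.inl
  snd := d.fst
  inl_fst := d.inr_snd
  inr_snd := d.inl_fst
  inl_snd := d.inr_fst
  inr_fst := d.inl_snd
  total := by rw [add_comm, d.total]

@[simp]
lemma inl_fst_assoc (d : ImageDecomposition U a b) {V : T} (f : X ⟶ V) :
    d.inl ≫ d.fst ≫ f = a ≫ f := by
  rw [← Category.assoc, d.inl_fst]

@[simp]
lemma inl_snd_assoc (d : ImageDecomposition U a b) {V : T} (f : Y ⟶ V) :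
    d.inl ≫ d.snd ≫ f = 0 := by
  rw [← Category.assoc, d.inl_snd, zero_comp]

@[simp]
lemma inr_fst_assoc (d : ImageDecomposition U a b) {V : T} (f : X ⟶ V) :
    d.inr ≫ d.fst ≫ f = 0 := by
  rw [← Category.assoc, d.inr_fst, zero_comp]

@[simp]
lemma inr_snd_assoc (d : ImageDecomposition U a b) {V : T} (f : Y ⟶ V) :
    d.inr ≫ d.snd ≫ f = b ≫ f := by
  rw [← Category.assoc, d.inr_snd]

lemma left_inl (d : ImageDecomposition U a b) : a ≫ d.inl = d.inl := by
  have := d.inl ≫= d.total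
  simpa using this

lemma left_inl_assoc (d : ImageDecomposition U a b) {V : T} (f : U ⟶ V) :
    a ≫ d.inl ≫ f = d.inl ≫ f := by
  rw [← Category.assoc, d.left_inl]

lemma fst_left (d : ImageDecomposition U a b) : d.fst ≫ a = d.fst := by
  have := d.total =≫ d.fst
  simpa using this

lemma right_inr (d : ImageDecomposition U a b) : b ≫ d.inr = d.inr :=
  d.swap.left_inl

lemma right_inr_assoc (d : ImageDecomposition U a b) {V : T} (f : U ⟶ V) :
    b ≫ d.inr ≫ f = d.inr ≫ f :=
  d.swap.left_inl_assoc f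

lemma snd_right (d : ImageDecomposition U a b) : d.snd ≫ b = d.snd :=
  d.swap.fst_left

/-- An idempotent endomorphism decomposes its object into its image and its kernel. -/
def ofIdempotent (p : X ⟶ X) (hp : p ≫ p = p) : ImageDecomposition X p (𝟙 X - p) where
  inl := p
  fst := p
  inr := 𝟙 X - p
  snd := 𝟙 X - p
  inl_fst := hp
  inr_snd := by simp [hp]
  inl_snd := by simp [hp]
  inr_fst := by simp [hp]
  total := by simp [hp]

/-- Transport of a decomposition along an isomorphism of the decomposed object. -/
def ofIso (d : ImageDecomposition U a b) {V : T} (e : U ≅ V) : ImageDecomposition V a b where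
  inl := d.inl ≫ e.hom
  fst := e.inv ≫ d.fst
  inr := d.inr ≫ e.hom
  snd := e.inv ≫ d.snd
  inl_fst := by simp
  inr_snd := by simp
  inl_snd := by simp
  inr_fst := by simp
  total := by
    have := e.inv ≫= d.total =≫ e.hom
    simpa using this

/-- Transport of a decomposition along an isomorphism of the second endomorphism. -/
def ofIsoRight (d : ImageDecomposition U a b) {Y' : T} {b' : Y' ⟶ Y'} (e : Y ≅ Y')
    (h : b ≫ e.hom = e.hom ≫ b') : ImageDecomposition U a b' where
  inl := d.inl
  fst := d.fst
  inr := e.inv ≫ d.inr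
  snd := d.snd ≫ e.hom
  inl_fst := by simp
  inr_snd := by simp [h]
  inl_snd := by simp
  inr_fst := by simp
  total := by simp [d.total]

/-- The image of a decomposition under an additive functor. -/
def map (d : ImageDecomposition U a b) {T' : Type*} [Category T'] [Preadditive T']
    (F : T ⥤ T') [F.Additive] : ImageDecomposition (F.obj U) (F.map a) (F.map b) where
  inl := F.map d.inl
  fst := F.map d.fst
  inr := F.map d.inr
  snd := F.map d.snd
  inl_fst := by rw [← F.map_comp, d.inl_fst]
  inr_snd := by rw [← F.map_comp, d.inr_snd]
  inl_snd := by rw [← F.map_comp, d.inl_snd, F.map_zero]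
  inr_fst := by rw [← F.map_comp, d.inr_fst, F.map_zero]
  total := by rw [← F.map_comp, ← F.map_comp, ← F.map_add, d.total, F.map_id]

lemma comp_eq_zero_of_complement {V : T} {f : U ⟶ X} {g : X ⟶ V} (hf : f ≫ a = f)
    (hg : (𝟙 X - a) ≫ g = g) : f ≫ g = 0 := by
  rw [← hg]
  simp [reassoc_of% hf]

/-- The decomposition of the image of a biproduct under an additive functor. -/
noncomputable def mapBiprod {T' : Type*} [Category T'] [Preadditive T'] (F : T ⥤ T')
    [F.Additive] (X Y : T) [HasBinaryBiproduct X Y] :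
    ImageDecomposition (F.obj (X ⊞ Y)) (𝟙 (F.obj X)) (𝟙 (F.obj Y)) where
  inl := F.map biprod.inl
  fst := F.map biprod.fst
  inr := F.map biprod.inr
  snd := F.map biprod.snd
  inl_fst := by simp [← F.map_comp]
  inr_snd := by simp [← F.map_comp]
  inl_snd := by simp [← F.map_comp]
  inr_fst := by simp [← F.map_comp]
  total := by rw [← F.map_comp, ← F.map_comp, ← F.map_add, biprod.total, F.map_id]

/-- If `P` and `Q` are the sums of the images of `a` and `b`, respectively of the complementary
idempotents, then the direct sum of the ambient objects is the direct sum of `P` and `Q`,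
with `a ⊕ b` corresponding to the projection onto `P`. -/
lemma exists_iso_conj_eq {A B P Q X W : T} {a : A ⟶ A} {b : B ⟶ B}
    (d : ImageDecomposition P a b) (d' : ImageDecomposition Q (𝟙 A - a) (𝟙 B - b))
    (D : ImageDecomposition X (𝟙 A) (𝟙 B)) (E : ImageDecomposition W (𝟙 P) (𝟙 Q)) :
    ∃ φ : X ≅ W, φ.inv ≫ (D.fst ≫ a ≫ D.inl + D.snd ≫ b ≫ D.inr) ≫ φ.hom =
      E.fst ≫ E.inl := by
  have hdl : d.fst ≫ d'.inl = 0 := comp_eq_zero_of_complement d.fst_left d'.left_inl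
  have hdr : d.snd ≫ d'.inr = 0 := comp_eq_zero_of_complement d.snd_right d'.right_inr
  have hdl' : d'.fst ≫ d.inl = 0 :=
    comp_eq_zero_of_complement d'.fst_left (by simpa using d.left_inl)
  have hdr' : d'.snd ≫ d.inr = 0 :=
    comp_eq_zero_of_complement d'.snd_right (by simpa using d.right_inr)
  have hal : a ≫ d'.inl = 0 := by simpa using d'.left_inl
  have har : b ≫ d'.inr = 0 := by simpa using d'.right_inr
  have hd : d.snd ≫ d.inr = 𝟙 P - d.fst ≫ d.inl := eq_sub_of_add_eq' d.total
  have hd' : d'.snd ≫ d'.inr = 𝟙 Q - d'.fst ≫ d'.inl := eq_sub_of_add_eq' d'.total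
  refine ⟨⟨D.fst ≫ (d.inl ≫ E.inl + d'.inl ≫ E.inr) +
      D.snd ≫ (d.inr ≫ E.inl + d'.inr ≫ E.inr),
    E.fst ≫ (d.fst ≫ D.inl + d.snd ≫ D.inr) +
      E.snd ≫ (d'.fst ≫ D.inl + d'.snd ≫ D.inr), ?_, ?_⟩, ?_⟩
  · rw [← D.total]
    simp
    abel
  · rw [← E.total]
    simp [reassoc_of% hdl, reassoc_of% hdr, reassoc_of% hdl', reassoc_of% hdr',
      reassoc_of% hd, reassoc_of% hd']
    abel
  · simp [d.left_inl_assoc, d.right_inr_assoc, reassoc_of% hdl', reassoc_of% hdr',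
      reassoc_of% hal, reassoc_of% har, reassoc_of% hd]

end Preadditive

section Pretriangulated

open Pretriangulated

variable {T : Type*} [Category T] [Preadditive T] [HasZeroObject T] [HasShift T ℤ]
  [∀ n : ℤ, (shiftFunctor T n).Additive] [Pretriangulated T]

/-- If `U` is the sum of the images of `a` and `b`, and `V` is the sum of the images of `c` and
`a`, then the cone of the map `U ⟶ V` through the common summand is the sum of the images of
`c` and of the shift of `b`. -/
lemma nonempty_cone {U V W X Y Z : T} {a : X ⟶ X} {b : Y ⟶ Y} {c : Z ⟶ Z}
    (d : ImageDecomposition U a b) (d' : ImageDecomposition V c a)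
    {i : V ⟶ W} {δ : W ⟶ U⟦(1 : ℤ)⟧}
    (h : Triangle.mk (d.fst ≫ d'.inr) i δ ∈ distTriang T) :
    Nonempty (ImageDecomposition W c (b⟦(1 : ℤ)⟧')) := by
  have hi : (d.fst ≫ d'.inr) ≫ i = 0 := comp_distTriang_mor_zero₁₂ _ h
  have hiδ : i ≫ δ = 0 := comp_distTriang_mor_zero₂₃ _ h
  have hδ : δ ≫ (d.fst ≫ d'.inr)⟦(1 : ℤ)⟧' = 0 := comp_distTriang_mor_zero₃₁ _ h
  obtain ⟨k, hk⟩ : ∃ k : W ⟶ Z, d'.fst = i ≫ k :=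
    Triangle.yoneda_exact₂ _ h d'.fst (by
      have : (d.fst ≫ d'.inr) ≫ d'.fst = 0 := by simp
      exact this)
  obtain ⟨l', hl'⟩ : ∃ l : Y⟦(1 : ℤ)⟧ ⟶ W, d.inr⟦(1 : ℤ)⟧' = l ≫ δ :=
    Triangle.coyoneda_exact₁ _ h (d.inr⟦(1 : ℤ)⟧') (by
      have : d.inr⟦(1 : ℤ)⟧' ≫ (d.fst ≫ d'.inr)⟦(1 : ℤ)⟧' = 0 := by
        rw [← Functor.map_comp, d.inr_fst_assoc, Functor.map_zero]
      exact this)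
  let D := d.map (shiftFunctor T (1 : ℤ))
  obtain ⟨l, hl, hbl⟩ : ∃ l : Y⟦(1 : ℤ)⟧ ⟶ W, l ≫ δ = D.inr ∧ b⟦(1 : ℤ)⟧' ≫ l = l := by
    refine ⟨b⟦(1 : ℤ)⟧' ≫ l', ?_, ?_⟩
    · rw [Category.assoc, ← hl']
      exact D.right_inr
    · have : b ≫ b = b := by
        conv_lhs => enter [2]; rw [← d.inr_snd]
        rw [d.right_inr_assoc, d.inr_snd]
      rw [← Category.assoc, ← Functor.map_comp, this]
  have hXi : d'.inr ≫ i = 0 := by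
    simpa [d'.right_inr_assoc] using d.inl ≫= hi
  have hδX : δ ≫ D.fst = 0 := by
    have := hδ =≫ d'.snd⟦(1 : ℤ)⟧'
    rw [Category.assoc, ← Functor.map_comp, Category.assoc, d'.inr_snd, d.fst_left,
      zero_comp] at this
    exact this
  have hVi : d'.fst ≫ d'.inl ≫ i = i := by
    have := d'.total =≫ i
    simpa [hXi] using this
  have hδY : δ ≫ D.snd ≫ D.inr = δ := by
    have := δ ≫= D.total
    simpa [reassoc_of% hδX] using this
  let k' := k - δ ≫ D.snd ≫ l ≫ k
  have hik' : i ≫ k' = d'.fst := by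
    simp [k', hk, reassoc_of% hiδ]
  have hlk' : l ≫ k' = 0 := by
    simp [k', reassoc_of% hl, reassoc_of% D.inr_snd, reassoc_of% hbl]
  have hlδ : l ≫ δ ≫ D.snd = b⟦(1 : ℤ)⟧' := by
    rw [← Category.assoc, hl, D.inr_snd]
  refine ⟨⟨d'.inl ≫ i, k', l, δ ≫ D.snd, by simp [hik'], hlδ, by simp [reassoc_of% hiδ],
    hlk', ?_⟩⟩
  let e := k' ≫ d'.inl ≫ i + (δ ≫ D.snd) ≫ l
  have hie : i ≫ (𝟙 W - e) = 0 := by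
    simp [e, reassoc_of% hik', reassoc_of% hiδ, hVi]
  have heδ : (𝟙 W - e) ≫ δ = 0 := by
    simp [e, hiδ, hl, hδY]
  obtain ⟨g, hg⟩ : ∃ g : U⟦(1 : ℤ)⟧ ⟶ W, 𝟙 W - e = δ ≫ g :=
    Triangle.yoneda_exact₃ _ h (𝟙 W - e) hie
  have hsq : (𝟙 W - e) ≫ (𝟙 W - e) = 0 := by
    nth_rw 2 [hg]
    rw [← Category.assoc, heδ, zero_comp]
  have hee : e ≫ e = e := by
    simp [e, reassoc_of% hik', reassoc_of% hiδ, reassoc_of% hlk', reassoc_of% hlδ, hVi, hbl]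
  have : 𝟙 W - e = 0 := by
    simpa [hee] using hsq
  exact (sub_eq_zero.1 this).symm

end Pretriangulated

end CategoryTheory.ImageDecomposition

open Pretriangulated in
/-- If a class of objects of a pretriangulated category is closed under shifts and cones, then
for an idempotent `p` on one of these objects and an odd `n`, the sum of the images of
`p` and `p⟦n⟧` is an object of this class. -/
lemma CategoryTheory.exists_imageDecomposition_shift
    {T : Type*} [Category T] [Preadditive T] [HasZeroObject T] [HasShift T ℤ]
    [∀ n : ℤ, (shiftFunctor T n).Additive] [Pretriangulated T]
    (S : ObjectProperty T) (hshift : ∀ (X : T) (n : ℤ), S X → S (X⟦n⟧))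
    (hcone : ∀ (X Y : T) (f : X ⟶ Y), S X → S Y →
      ∃ (Z : T) (i : Y ⟶ Z) (δ : Z ⟶ X⟦(1 : ℤ)⟧), S Z ∧ Triangle.mk f i δ ∈ distTriang T)
    {X : T} (hX : S X) (p : X ⟶ X) (hp : p ≫ p = p) (m : ℕ) :
    ∃ P : T, S P ∧ Nonempty (ImageDecomposition P p (p⟦(2 * m + 1 : ℤ)⟧')) := by
  have step : ∀ {U V X Y Z : T} {a : X ⟶ X} {b : Y ⟶ Y} {c : Z ⟶ Z},
      S U → S V → ImageDecomposition U a b → ImageDecomposition V c a →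
      ∃ W : T, S W ∧ Nonempty (ImageDecomposition W c (b⟦(1 : ℤ)⟧')) := by
    intro U V X Y Z a b c hU hV d d'
    obtain ⟨W, i, δ, hW, h⟩ := hcone U V (d.fst ≫ d'.inr) hU hV
    exact ⟨W, hW, d.nonempty_cone d' h⟩
  obtain ⟨P₁, hP₁, ⟨d₁⟩⟩ := step hX hX (ImageDecomposition.ofIdempotent p hp).swap
    (ImageDecomposition.ofIdempotent p hp)
  induction m with
  | zero => exact ⟨P₁, hP₁, ⟨d₁⟩⟩
  | succ m ih =>
    obtain ⟨P, hP, ⟨d⟩⟩ := ih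
    obtain ⟨W, hW, ⟨d'⟩⟩ := step (hshift P₁ (2 * m + 1) hP₁) hP
      (d₁.map (shiftFunctor T (2 * m + 1 : ℤ))) d
    let e : shiftFunctor T (2 * (m + 1 : ℕ) + 1 : ℤ) ≅
        (shiftFunctor T (1 : ℤ) ⋙ shiftFunctor T (2 * m + 1 : ℤ)) ⋙ shiftFunctor T (1 : ℤ) :=
      shiftFunctorAdd' T (1 + (2 * m + 1) : ℤ) 1 _ (by push_cast; ring) ≪≫
        Functor.isoWhiskerRight (shiftFunctorAdd' T (1 : ℤ) (2 * m + 1) _ rfl) _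
    exact ⟨W, hW, ⟨d'.ofIsoRight (e.symm.app X) (e.inv.naturality p)⟩⟩

namespace CochainComplex

variable {C : Type*} [Category C] [Preadditive C]

lemma IsBoundedComplex.shift {A : CochainComplex C ℤ} (hA : A.IsBoundedComplex) (n : ℤ) :
    (A⟦n⟧).IsBoundedComplex := by
  obtain ⟨a, b, h⟩ := hA
  exact ⟨a - n, b - n, fun i hi => h (i + n) (by lia)⟩

lemma IsBoundedComplex.mappingCone [HasBinaryBiproducts C] {A B : CochainComplex C ℤ}
    (f : A ⟶ B) (hA : A.IsBoundedComplex) (hB : B.IsBoundedComplex) :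
    (CochainComplex.mappingCone f).IsBoundedComplex := by
  obtain ⟨a, b, h⟩ := hA
  obtain ⟨a', b', h'⟩ := hB
  refine ⟨min (a - 1) a', max (b - 1) b', fun i hi => ?_⟩
  rw [mappingCone.isZero_X_iff]
  exact ⟨h _ (by lia), h' _ (by lia)⟩

lemma IsBoundedComplex.hasZeroObject {A : CochainComplex C ℤ} (hA : A.IsBoundedComplex) :
    HasZeroObject C := by
  obtain ⟨a, b, h⟩ := hA
  exact ⟨A.X (a - 1), h _ (by lia)⟩

end CochainComplex

namespace HomotopyCategory

variable {C : Type*} [Category C] [Preadditive C]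

/-- The objects of the homotopy category which are isomorphic to a bounded complex. -/
def isBounded (C : Type*) [Category C] [Preadditive C] :
    ObjectProperty (HomotopyCategory C (ComplexShape.up ℤ)) :=
  fun X => ∃ P : CochainComplex C ℤ, P.IsBoundedComplex ∧
    Nonempty (X ≅ (quotient C (ComplexShape.up ℤ)).obj P)

lemma isBounded_shift (X : HomotopyCategory C (ComplexShape.up ℤ)) (n : ℤ)
    (hX : isBounded C X) : isBounded C (X⟦n⟧) := by
  obtain ⟨P, hP, ⟨e⟩⟩ := hX
  exact ⟨P⟦n⟧, hP.shift n, ⟨(shiftFunctor _ n).mapIso e ≪≫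
    (((quotient C (ComplexShape.up ℤ)).commShiftIso n).app P).symm⟩⟩

open Pretriangulated in
lemma exists_isBounded_cone [HasZeroObject C] [HasBinaryBiproducts C]
    (X Y : HomotopyCategory C (ComplexShape.up ℤ)) (f : X ⟶ Y)
    (hX : isBounded C X) (hY : isBounded C Y) :
    ∃ (Z : HomotopyCategory C (ComplexShape.up ℤ)) (i : Y ⟶ Z) (δ : Z ⟶ X⟦(1 : ℤ)⟧),
      isBounded C Z ∧ Triangle.mk f i δ ∈ distTriang _ := by
  obtain ⟨P, hP, ⟨e⟩⟩ := hX
  obtain ⟨Q, hQ, ⟨e'⟩⟩ := hY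
  obtain ⟨g, hg⟩ := (quotient C (ComplexShape.up ℤ)).map_surjective (e.inv ≫ f ≫ e'.hom)
  let t := CochainComplex.mappingCone.triangleh g
  refine ⟨t.obj₃, e'.hom ≫ t.mor₂, t.mor₃ ≫ e.inv⟦(1 : ℤ)⟧',
    ⟨CochainComplex.mappingCone g, hP.mappingCone g hQ, ⟨Iso.refl _⟩⟩, ?_⟩
  refine CategoryTheory.Pretriangulated.isomorphic_distinguished _
    (mappingCone_triangleh_distinguished g) _
    (Triangle.isoMk _ _ e e' (Iso.refl _) ?_ ?_ ?_)
  · have : f ≫ e'.hom = e.hom ≫ (quotient C (ComplexShape.up ℤ)).map g := by simp [hg]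
    exact this
  · exact Category.comp_id _
  · have : (t.mor₃ ≫ e.inv⟦(1 : ℤ)⟧') ≫ e.hom⟦(1 : ℤ)⟧' = 𝟙 _ ≫ t.mor₃ := by
      rw [Category.assoc, Category.id_comp]
      refine (t.mor₃ ≫= ?_).trans (Category.comp_id _)
      exact ((shiftFunctor _ (1 : ℤ)).mapIso e).inv_hom_id
    exact this

end HomotopyCategory

/-- Splitting of homotopy idempotents after stabilization: if `A` is a bounded
complex over an additive category `C` and `p : A → A` is a chain map which is
idempotent up to homotopy (i.e. an idempotent in the bounded homotopy category),
then for every odd `n ≥ 1` there are bounded complexes `P`, `Q` and an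
isomorphism `φ : A ⊕ A[n] ≅ P ⊕ Q` in the homotopy category under which the
endomorphism `p ⊕ p[n]` corresponds to `id_P ⊕ 0`. -/
theorem homotopy_idempotent_stable_splitting
    {C : Type*} [Category C] [Preadditive C] [HasBinaryBiproducts C]
    (A : CochainComplex C ℤ) (hA : A.IsBoundedComplex)
    (p : A ⟶ A) (hp : Homotopy (p ≫ p) p)
    (n : ℤ) (hodd : Odd n) (hpos : 1 ≤ n) :
    ∃ (P Q : CochainComplex C ℤ), P.IsBoundedComplex ∧ Q.IsBoundedComplex ∧
      ∃ φ : (HomotopyCategory.quotient C (ComplexShape.up ℤ)).obj (A ⊞ (A⟦n⟧)) ≅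
            (HomotopyCategory.quotient C (ComplexShape.up ℤ)).obj (P ⊞ Q),
        φ.inv ≫
            (HomotopyCategory.quotient C (ComplexShape.up ℤ)).map
              (biprod.map p ((CategoryTheory.shiftFunctor (CochainComplex C ℤ) n).map p)) ≫
            φ.hom =
          (HomotopyCategory.quotient C (ComplexShape.up ℤ)).map
            (biprod.map (𝟙 P) (0 : Q ⟶ Q)) := by
  have := hA.hasZeroObject
  obtain ⟨m, rfl⟩ : ∃ m : ℕ, n = 2 * m + 1 := by
    obtain ⟨k, hk⟩ := hodd
    exact ⟨k.toNat, by lia⟩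
  let F := HomotopyCategory.quotient C (ComplexShape.up ℤ)
  have hp' : F.map p ≫ F.map p = F.map p := by
    rw [← F.map_comp]
    exact HomotopyCategory.eq_of_homotopy _ _ hp
  have key (f : A ⟶ A) (hf : F.map f ≫ F.map f = F.map f) :
      ∃ P : CochainComplex C ℤ, P.IsBoundedComplex ∧
        Nonempty (ImageDecomposition (F.obj P) (F.map f) (F.map (f⟦(2 * m + 1 : ℤ)⟧'))) := by
    obtain ⟨P, ⟨P', hP', ⟨i⟩⟩, ⟨d⟩⟩ := exists_imageDecomposition_shift
      (HomotopyCategory.isBounded C) HomotopyCategory.isBounded_shift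
      HomotopyCategory.exists_isBounded_cone (X := F.obj A) ⟨A, hA, ⟨Iso.refl _⟩⟩ (F.map f) hf m
    exact ⟨P', hP', ⟨(d.ofIso i).ofIsoRight
      ((F.commShiftIso (2 * m + 1 : ℤ)).app A).symm
      ((F.commShiftIso (2 * m + 1 : ℤ)).inv.naturality f)⟩⟩
  obtain ⟨P, hP, ⟨d⟩⟩ := key p hp'
  obtain ⟨Q, hQ, ⟨d'⟩⟩ := key (𝟙 A - p) (by simp [hp'])
  refine ⟨P, Q, hP, hQ, ?_⟩
  simp only [Functor.map_sub, CategoryTheory.Functor.map_id] at d'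
  obtain ⟨φ, hφ⟩ := d.exists_iso_conj_eq d' (.mapBiprod F A (A⟦(2 * m + 1 : ℤ)⟧))
    (.mapBiprod F P Q)
  refine ⟨φ, ?_⟩
  have hA' : biprod.map p (p⟦(2 * m + 1 : ℤ)⟧') = biprod.fst ≫ p ≫ biprod.inl +
      biprod.snd ≫ p⟦(2 * m + 1 : ℤ)⟧' ≫ biprod.inr := by
    apply biprod.hom_ext' <;> simp
  have hPQ : biprod.map (𝟙 P) (0 : Q ⟶ Q) = biprod.fst ≫ biprod.inl := by
    apply biprod.hom_ext' <;> simp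
  rw [hA', hPQ]
  simpa [ImageDecomposition.mapBiprod] using hφ
end

section
/- Let 𝒞 be an additive category which is Karoubian (idempotent complete), i.e., every idempotent endomorphism in 𝒞 splits. Then the bounded homotopy category K^b(𝒞) is Karoubian: every idempotent endomorphism in K^b(𝒞) splits, i.e., for every object A and every morphism p : A → A with p ∘ p = p in K^b(𝒞), there exist an object P and morphisms r : A → P, s : P → A with r ∘ s = id_P and s ∘ r = p. -/
open CategoryTheory Limits

/-- Idempotents of complexes split degreewise. -/
instance HomologicalComplex.instIsIdempotentComplete {C ι : Type*} [Category C]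
    [HasZeroMorphisms C] [IsIdempotentComplete C] (c : ComplexShape ι) :
    IsIdempotentComplete (HomologicalComplex C c) where
  idempotents_split K e he := by
    have hf (i : ι) : e.f i ≫ e.f i = e.f i := by rw [← HomologicalComplex.comp_f, he]
    choose Y j q hjq hqj using fun i =>
      IsIdempotentComplete.idempotents_split (K.X i) (e.f i) (hf i)
    have hj (i i' : ι) : j i ≫ K.d i i' ≫ q i' ≫ j i' = j i ≫ K.d i i' := by
      rw [hqj, ← e.comm, ← hqj, ← Category.assoc, ← Category.assoc (j i), hjq, Category.id_comp]
    have hq (i i' : ι) : q i ≫ j i ≫ K.d i i' ≫ q i' = K.d i i' ≫ q i' := by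
      rw [← Category.assoc, hqj, ← Category.assoc, e.comm, ← hqj, Category.assoc, Category.assoc,
        hjq, Category.comp_id]
    let P : HomologicalComplex C c :=
      { X := Y
        d i i' := j i ≫ K.d i i' ≫ q i'
        shape i i' h := by simp [K.shape i i' h]
        d_comp_d' i i' i'' _ _ := by simp [hq] }
    exact ⟨P, { f := j, comm' i i' _ := by simp [P, hj] },
      { f := q, comm' i i' _ := by simp [P, hq] },
      by ext i; exact hjq i, by ext i; exact hqj i⟩

/-- If `p = r ≫ s` and `𝟙 - s ≫ r` factors through `W`, then one can pass to a cone in order that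
the complementary idempotent factors through `W⟦1⟧`. -/
lemma CategoryTheory.Pretriangulated.exists_factorization_through_cone {D : Type*} [Category D]
    [Preadditive D] [HasZeroObject D] [HasShift D ℤ] [∀ n : ℤ, (shiftFunctor D n).Additive]
    [Pretriangulated D] {A T W T' : D} {p : A ⟶ A} {r : A ⟶ T} {s : T ⟶ A} {u : T ⟶ W} {v : W ⟶ T}
    (hp : p ≫ p = p) (hrs : r ≫ s = p) (hpr : p ≫ r = r) (hsp : s ≫ p = s)
    (huv : u ≫ v = 𝟙 T - s ≫ r) {w : W ⟶ T} (hw : w = v ≫ (𝟙 T - s ≫ r))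
    {i : T ⟶ T'} {δ : T' ⟶ W⟦(1 : ℤ)⟧} (hdist : Triangle.mk w i δ ∈ distTriang D) :
    ∃ (r' : A ⟶ T') (s' : T' ⟶ A) (v' : W⟦(1 : ℤ)⟧ ⟶ T'),
      r' ≫ s' = p ∧ p ≫ r' = r' ∧ s' ≫ p = s' ∧ δ ≫ v' = 𝟙 T' - s' ≫ r' := by
  have hws : w ≫ s = 0 := by simp [hw, hrs, hsp]
  obtain ⟨s' : T' ⟶ A, hs' : s = i ≫ s'⟩ := Triangle.yoneda_exact₂ _ hdist s hws
  have hwi : w ≫ i = 0 := comp_distTriang_mor_zero₁₂ _ hdist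
  have hei : (𝟙 T - s ≫ r) ≫ i = 0 := by
    have : u ≫ w = 𝟙 T - s ≫ r := by
      rw [hw, ← Category.assoc, huv]
      simp [reassoc_of% hrs, hpr]
    rw [← this, Category.assoc, hwi, comp_zero]
  obtain ⟨v', hv' : 𝟙 T' - (s' ≫ p) ≫ r ≫ i = δ ≫ v'⟩ :=
    Triangle.yoneda_exact₃ _ hdist (𝟙 T' - (s' ≫ p) ≫ r ≫ i) (by
      change i ≫ (𝟙 T' - (s' ≫ p) ≫ r ≫ i) = 0
      rw [← hei]
      simp [reassoc_of% hpr, ← reassoc_of% hs'])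
  refine ⟨r ≫ i, s' ≫ p, v', ?_, ?_, ?_, hv'.symm⟩
  · rw [Category.assoc, ← reassoc_of% hs', hsp, hrs]
  · rw [reassoc_of% hpr]
  · rw [Category.assoc, hp]

open HomotopyCategory in
/-- For each `n`, an idempotent `p` of `A` in the homotopy category factors as `r ≫ s` through a
complex `T` bounded above like `A`, in such a way that `𝟙 - s ≫ r` factors through a complex which
is bounded above by `b - n`. -/
lemma CochainComplex.exists_approximate_splitting {C : Type*} [Category C] [Preadditive C]
    [HasZeroObject C] [HasBinaryBiproducts C] (A : CochainComplex C ℤ) (b : ℤ) [A.IsStrictlyLE b]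
    (p : (quotient C (ComplexShape.up ℤ)).obj A ⟶ (quotient C (ComplexShape.up ℤ)).obj A)
    (hp : p ≫ p = p) (n : ℕ) :
    ∃ (T W : CochainComplex C ℤ) (_ : T.IsStrictlyLE b) (_ : W.IsStrictlyLE (b - n))
      (r : (quotient C (ComplexShape.up ℤ)).obj A ⟶ (quotient C (ComplexShape.up ℤ)).obj T)
      (s : (quotient C (ComplexShape.up ℤ)).obj T ⟶ (quotient C (ComplexShape.up ℤ)).obj A)
      (u : (quotient C (ComplexShape.up ℤ)).obj T ⟶ (quotient C (ComplexShape.up ℤ)).obj W)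
      (v : (quotient C (ComplexShape.up ℤ)).obj W ⟶ (quotient C (ComplexShape.up ℤ)).obj T),
      r ≫ s = p ∧ p ≫ r = r ∧ s ≫ p = s ∧ u ≫ v = 𝟙 _ - s ≫ r := by
  induction n with
  | zero =>
    exact ⟨A, A, inferInstance, by simpa, p, p, 𝟙 _, 𝟙 _ - p, hp, hp, hp, by simp [hp]⟩
  | succ n ih =>
    obtain ⟨T, W, _, _, r, s, u, v, hrs, hpr, hsp, huv⟩ := ih
    obtain ⟨w, hw⟩ := (quotient C (ComplexShape.up ℤ)).map_surjective (v ≫ (𝟙 _ - s ≫ r))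
    obtain ⟨r', s', v', hrs', hpr', hsp', hδ⟩ :=
      Pretriangulated.exists_factorization_through_cone hp hrs hpr hsp huv hw
        (mappingCone_triangleh_distinguished w)
    refine ⟨mappingCone w, W⟦(1 : ℤ)⟧, ?_, ?_, r', s',
      (quotient C (ComplexShape.up ℤ)).map (mappingCone.triangle w).mor₃,
      ((quotient C (ComplexShape.up ℤ)).commShiftIso (1 : ℤ)).hom.app W ≫ v', hrs', hpr', hsp', ?_⟩
    · rw [CochainComplex.isStrictlyLE_iff]
      intro k hk
      rw [CochainComplex.mappingCone.isZero_X_iff]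
      exact ⟨W.isZero_of_isStrictlyLE (b - n) _, T.isZero_of_isStrictlyLE b _⟩
    · rw [CochainComplex.isStrictlyLE_iff]
      intro k hk
      exact W.isZero_of_isStrictlyLE (b - n) (k + 1) (by push_cast at hk; lia)
    · exact (Category.assoc _ _ _).symm.trans hδ

/-- A complex which is contracted by `h` in degree `m` has an idempotent endomorphism
vanishing in degrees `< m` and equal to the identity in degrees `> m`. -/
lemma CochainComplex.exists_truncation_idempotent {C : Type*} [Category C] [Preadditive C]
    (T : CochainComplex C ℤ) (m : ℤ) (h : ∀ i j, T.X i ⟶ T.X j)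
    (hm : T.d m (m + 1) ≫ h (m + 1) m + h m (m - 1) ≫ T.d (m - 1) m = 𝟙 _) :
    ∃ e : T ⟶ T, e ≫ e = e ∧ (∀ i < m, e.f i = 0) ∧ ∀ i, m < i → e.f i = 𝟙 _ := by
  have hd : T.d m (m + 1) ≫ h (m + 1) m ≫ T.d m (m + 1) = T.d m (m + 1) := by
    simpa using hm =≫ T.d m (m + 1)
  let f (i : ℤ) : T.X i ⟶ T.X i := if i < m then 0 else if i = m then dNext i h else 𝟙 _
  have hlt (i : ℤ) (hi : i < m) : f i = 0 := if_pos hi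
  have hgt (i : ℤ) (hi : m < i) : f i = 𝟙 _ := by
    simp [f, show ¬ i < m by lia, show i ≠ m by lia]
  have heq : f m = T.d m (m + 1) ≫ h (m + 1) m := by
    rw [← dNext_eq h (show (ComplexShape.up ℤ).Rel m (m + 1) from rfl)]
    simp only [f, lt_irrefl, if_true, if_false]
  refine ⟨{ f := f, comm' := ?_ }, ?_, hlt, hgt⟩
  · rintro i _ rfl
    rcases lt_trichotomy i m with hi | rfl | hi
    · rw [hlt i hi, zero_comp]
      obtain hi' | rfl := (show i + 1 ≤ m by lia).lt_or_eq
      · rw [hlt _ hi', comp_zero]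
      · rw [heq, T.d_comp_d_assoc, zero_comp]
    · rw [heq, hgt _ (by lia), Category.assoc, hd, Category.comp_id]
    · rw [hgt i hi, hgt _ (by lia), Category.comp_id, Category.id_comp]
  · ext i
    change f i ≫ f i = f i
    rcases lt_trichotomy i m with hi | rfl | hi
    · rw [hlt i hi, comp_zero]
    · rw [heq, Category.assoc, reassoc_of% hd]
    · rw [hgt i hi, Category.comp_id]

/-- The bounded homotopy category of a Karoubian (idempotent complete) additive
category is Karoubian: any idempotent `p` on a bounded complex `A`, viewed in the
homotopy category, splits through a bounded complex `P` via maps `r : A → P`,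
`s : P → A` with `r ∘ s = id_P` and `s ∘ r = p`. -/
theorem bounded_homotopy_category_idempotent_complete
    {C : Type*} [Category C] [Preadditive C] [HasBinaryBiproducts C]
    [IsIdempotentComplete C]
    (A : CochainComplex C ℤ) (hA : A.IsBoundedComplex)
    (p : (HomotopyCategory.quotient C (ComplexShape.up ℤ)).obj A ⟶
         (HomotopyCategory.quotient C (ComplexShape.up ℤ)).obj A)
    (hp : p ≫ p = p) :
    ∃ (P : CochainComplex C ℤ), P.IsBoundedComplex ∧
      ∃ (r : (HomotopyCategory.quotient C (ComplexShape.up ℤ)).obj A ⟶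
             (HomotopyCategory.quotient C (ComplexShape.up ℤ)).obj P)
        (s : (HomotopyCategory.quotient C (ComplexShape.up ℤ)).obj P ⟶
             (HomotopyCategory.quotient C (ComplexShape.up ℤ)).obj A),
        s ≫ r = 𝟙 ((HomotopyCategory.quotient C (ComplexShape.up ℤ)).obj P) ∧
        r ≫ s = p := by
  obtain ⟨a, b, hab⟩ := hA
  have : HasZeroObject C := ⟨_, hab (b + 1) (Or.inr (by lia))⟩
  have : A.IsStrictlyLE b := by
    rw [CochainComplex.isStrictlyLE_iff]
    exact fun i hi => hab i (Or.inr hi)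
  obtain ⟨n, hn⟩ : ∃ n : ℕ, b - n < a - 1 := ⟨(b - a + 2).toNat, by lia⟩
  obtain ⟨T, W, _, _, r, s, u, v, hrs, -, -, huv⟩ := A.exists_approximate_splitting b p hp n
  let Q := HomotopyCategory.quotient C (ComplexShape.up ℤ)
  obtain ⟨r, rfl⟩ := Q.map_surjective r
  obtain ⟨s, rfl⟩ := Q.map_surjective s
  obtain ⟨u, rfl⟩ := Q.map_surjective u
  obtain ⟨v, rfl⟩ := Q.map_surjective v
  have hW (i : ℤ) (hi : a - 1 ≤ i) : IsZero (W.X i) :=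
    W.isZero_of_isStrictlyLE (b - n) i (by lia)
  let h : Homotopy (𝟙 T) (s ≫ r + u ≫ v) := HomotopyCategory.homotopyOfEq _ _ (by
    change Q.map (𝟙 T) = Q.map (s ≫ r + u ≫ v)
    rw [Functor.map_add, Q.map_comp, Q.map_comp, Q.map_id, huv, add_sub_cancel])
  obtain ⟨e, he, hlt, hgt⟩ := T.exists_truncation_idempotent (a - 1) h.hom (by
    have := h.comm (a - 1)
    rw [dNext_eq _ (show (ComplexShape.up ℤ).Rel (a - 1) (a - 1 + 1) from rfl),
      prevD_eq _ (show (ComplexShape.up ℤ).Rel (a - 1 - 1) (a - 1) by simp)] at this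
    simpa [(hab (a - 1) (Or.inl (by lia))).eq_of_src (r.f (a - 1)) 0,
      (hW (a - 1) le_rfl).eq_of_src (v.f (a - 1)) 0] using this.symm)
  obtain ⟨P, j, q, hjq, hqj⟩ := IsIdempotentComplete.idempotents_split T e he
  have hjq' (i : ℤ) : j.f i ≫ q.f i = 𝟙 _ := by
    rw [← HomologicalComplex.comp_f, hjq, HomologicalComplex.id_f]
  have hPlt (i : ℤ) (hi : i < a - 1) : IsZero (P.X i) := by
    rw [IsZero.iff_id_eq_zero]
    have : q.f i ≫ j.f i = 0 := by rw [← HomologicalComplex.comp_f, hqj, hlt i hi]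
    calc 𝟙 (P.X i) = j.f i ≫ (q.f i ≫ j.f i) ≫ q.f i := by simp [hjq']
      _ = 0 := by simp [this]
  have hPgt (i : ℤ) (hi : b < i) : IsZero (P.X i) := by
    rw [IsZero.iff_id_eq_zero, ← hjq',
      (T.isZero_of_isStrictlyLE b i hi).eq_of_src (q.f i) 0, comp_zero]
  have hju : j ≫ u = 0 := by
    ext i
    by_cases hi : i < a - 1
    · exact (hPlt i hi).eq_of_src _ _
    · exact (hW i (by lia)).eq_of_tgt _ _
  have hre : r ≫ e = r := by
    ext i
    by_cases hi : i < a
    · exact (hab i (Or.inl hi)).eq_of_src _ _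
    · simp [hgt i (by lia)]
  refine ⟨P, ⟨a - 1, b, fun i hi => hi.elim (hPlt i) (hPgt i)⟩,
    Q.map (r ≫ q), Q.map (j ≫ s), ?_, ?_⟩
  · have hsr : Q.map (s ≫ r) = Q.map (𝟙 T - u ≫ v) := by
      rw [Functor.map_sub, Q.map_comp u v, Q.map_id, huv, sub_sub_cancel, Q.map_comp]
    calc Q.map (j ≫ s) ≫ Q.map (r ≫ q) = Q.map j ≫ Q.map (s ≫ r) ≫ Q.map q := by simp
      _ = Q.map (j ≫ (𝟙 T - u ≫ v) ≫ q) := by rw [hsr, Q.map_comp, Q.map_comp]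
      _ = 𝟙 (Q.obj P) := by simp [hjq, reassoc_of% hju]
  · rw [← Q.map_comp, Category.assoc, ← Category.assoc q, hqj, reassoc_of% hre, Q.map_comp, hrs]
end
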